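/- (Variance control inequality.) Let s₂ ≥ 1 be a real number and let 0 < σ₋ < σ₊ with σ₊ ≤ 2σ₋. Then for all real a, b with σ₋ < a ≤ σ₊ and σ₋ < b ≤ σ₊: (min(a, b))^{s₂} · (σ₊^{s₂} − σ₋^{s₂}) ≤ 2^{s₂} · a^{s₂} · b^{s₂}. -/

import Mathlib

/-- variance control inequality for the geometric-level sampling estimator. -/
theorem variance_control (s₂ σm σp : ℝ) (hs : 1 ≤ s₂) (h0 : 0 < σm) (hlt : σm < σp)
    (h2 : σp ≤ 2 * σm) (a b : ℝ) (ha1 : σm < a) (ha2 : a ≤ σp) (hb1 : σm < b) (hb2 : b ≤ σp) :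
    min a b ^ s₂ * (σp ^ s₂ - σm ^ s₂) ≤ 2 ^ s₂ * a ^ s₂ * b ^ s₂ := by
  have ha : 0 < a := h0.trans ha1
  have hb : 0 < b := h0.trans hb1
  have hmin : 0 ≤ min a b := le_min ha.le hb.le
  have hmax : 0 ≤ max a b := le_max_of_le_left ha.le
  have hσ : σp ≤ 2 * max a b := by linarith [le_max_left a b]
  calc min a b ^ s₂ * (σp ^ s₂ - σm ^ s₂)
      ≤ min a b ^ s₂ * (2 * max a b) ^ s₂ := by
        refine mul_le_mul_of_nonneg_left ?_ (Real.rpow_nonneg hmin s₂)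
        exact (sub_le_self _ (Real.rpow_nonneg h0.le s₂)).trans
          (Real.rpow_le_rpow (h0.trans hlt).le hσ (zero_le_one.trans hs))
    _ = 2 ^ s₂ * (min a b * max a b) ^ s₂ := by
        rw [Real.mul_rpow zero_le_two hmax, Real.mul_rpow hmin hmax]
        ring
    _ = 2 ^ s₂ * a ^ s₂ * b ^ s₂ := by
        rw [min_mul_max, Real.mul_rpow ha.le hb.le, mul_assoc]
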